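/- Let p be an odd prime, R = F_p + vF_p with v^2 = v, θ = λ + vμ a unit of R, and C a θ-constacyclic code of length n over R with generating set in standard form {v·g_{1−v}(x), (1−v)·g_v(x)}. Write x^n − (λ+μ) = g_{1−v}(x)h_{1−v}(x) and x^n − λ = g_v(x)h_v(x), and let h*_{1−v}(x), h*_v(x) be the monic reciprocal polynomials of h_{1−v}(x), h_v(x). Then the dual code C^⊥ is the principal ideal ⟨v·h*_{1−v}(x) + (1−v)·h*_v(x)⟩ of R[x]/⟨x^n − θ^{−1}⟩. -/

import Mathlib

open Polynomial

def vR (p : ℕ) : ZMod p × ZMod p := (0, 1)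

def ofFHom (p : ℕ) : ZMod p →+* ZMod p × ZMod p :=
  RingHom.prod (RingHom.id _) (RingHom.id _)

def shift {m : ℕ} {S : Type*} [Mul S] (θ : S) (c : Fin m → S) : Fin m → S :=
  fun i =>
    if h : (i : ℕ) = 0 then θ * c ⟨m - 1, by have := i.isLt; omega⟩
    else c ⟨(i : ℕ) - 1, by have := i.isLt; omega⟩

def IsConstacyclic {m : ℕ} {S : Type*} [Mul S] (θ : S) (C : Set (Fin m → S)) : Prop :=
  ∀ c ∈ C, shift θ c ∈ C

def dualCode {m : ℕ} {S : Type*} [CommRing S] (C : Set (Fin m → S)) : Set (Fin m → S) :=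
  {u | ∀ w ∈ C, ∑ i, u i * w i = 0}

/-- identification of a word `(c_0, …, c_{m-1}) ∈ S^m` with the polynomial
`c_0 + c_1 x + ⋯ + c_{m-1} x^{m-1}`. -/
noncomputable def toPoly {m : ℕ} {S : Type*} [Semiring S] (c : Fin m → S) : S[X] :=
  ∑ i : Fin m, Polynomial.C (c i) * X ^ (i : ℕ)

/-- The monic reciprocal polynomial `h*(x) = h(0)⁻¹ · x^{deg h} · h(1/x)`. -/
noncomputable def recip {p : ℕ} (h : (ZMod p)[X]) : (ZMod p)[X] :=
  Polynomial.C (h.coeff 0)⁻¹ * h.reverse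

section toPoly

variable {n : ℕ} {S T : Type*} [Semiring S] [Semiring T]

theorem coeff_toPoly (c : Fin n → S) (i : ℕ) :
    (toPoly c).coeff i = if h : i < n then c ⟨i, h⟩ else 0 := by
  simp only [toPoly, finsetSum_coeff, coeff_C_mul, coeff_X_pow]
  split_ifs with h
  · rw [Finset.sum_eq_single ⟨i, h⟩]
    · simp
    · intro b _ hb
      have : i ≠ b := fun e => hb (Fin.ext e.symm)
      simp [this]
    · simp
  · refine Finset.sum_eq_zero fun b _ => ?_
    have : i ≠ b := by have := b.isLt; omega
    simp [this]

theorem degree_toPoly_lt (c : Fin n → S) : (toPoly c).degree < n := by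
  rw [degree_lt_iff_coeff_zero]
  intro m hm
  rw [coeff_toPoly, dif_neg (by omega)]

theorem toPoly_coeff {P : S[X]} (hP : P.degree < n) :
    toPoly (fun i : Fin n => P.coeff i) = P := by
  ext i
  rw [coeff_toPoly]
  split_ifs with h
  · rfl
  · exact (degree_lt_iff_coeff_zero _ _ |>.1 hP i (by omega)).symm

theorem toPoly_injective : Function.Injective (toPoly : (Fin n → S) → S[X]) := by
  intro c d h
  funext i
  simpa [coeff_toPoly] using congrArg (fun P => P.coeff (i : ℕ)) h

theorem map_toPoly (f : S →+* T) (c : Fin n → S) :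
    (toPoly c).map f = toPoly (fun i => f (c i)) := by
  simp [toPoly, Polynomial.map_sum]

end toPoly

section Quotient

variable {n : ℕ} {S : Type*} [CommRing S] [Nontrivial S]

theorem exists_toPoly_mk_eq (hn : 0 < n) (a : S)
    (x : S[X] ⧸ Ideal.span {(X : S[X]) ^ n - C a}) :
    ∃ u : Fin n → S, x = Ideal.Quotient.mk _ (toPoly u) := by
  obtain ⟨P, rfl⟩ := Ideal.Quotient.mk_surjective x
  have hm : ((X : S[X]) ^ n - C a).Monic := monic_X_pow_sub_C a hn.ne'
  have hd : (P %ₘ (X ^ n - C a)).degree < n := by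
    simpa [degree_X_pow_sub_C hn a] using degree_modByMonic_lt P hm
  refine ⟨fun i => (P %ₘ (X ^ n - C a)).coeff i, ?_⟩
  rw [toPoly_coeff hd, Ideal.Quotient.eq, Ideal.mem_span_singleton]
  exact ⟨P /ₘ (X ^ n - C a), by linear_combination -(modByMonic_add_div P (X ^ n - C a))⟩

theorem mk_toPoly_injective (hn : 0 < n) (a : S) {u w : Fin n → S}
    (h : Ideal.Quotient.mk (Ideal.span {(X : S[X]) ^ n - C a}) (toPoly u) =
      Ideal.Quotient.mk _ (toPoly w)) : u = w := by
  rw [Ideal.Quotient.eq, Ideal.mem_span_singleton] at h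
  refine toPoly_injective (sub_eq_zero.1 ?_)
  by_contra h0
  refine (monic_X_pow_sub_C a hn.ne').not_dvd_of_degree_lt h0 ?_ h
  rw [degree_X_pow_sub_C hn a]
  exact (degree_sub_le _ _).trans_lt (max_lt (degree_toPoly_lt _) (degree_toPoly_lt _))

end Quotient

section Field

variable {F : Type*} [Field F]

theorem reverse_dvd_reflect {h f : F[X]} {N : ℕ} (hf : f.natDegree ≤ N) (hd : h ∣ f) :
    h.reverse ∣ reflect N f := by
  rcases eq_or_ne f 0 with rfl | h0
  · simp
  obtain ⟨s, rfl⟩ := hd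
  rw [natDegree_mul (left_ne_zero_of_mul h0) (right_ne_zero_of_mul h0)] at hf
  have : N = h.natDegree + (N - h.natDegree) := by omega
  rw [this, reflect_mul h s le_rfl (by omega)]
  exact dvd_mul_right _ _

theorem reverse_reverse_of_coeff_zero_ne {h : F[X]} (h0 : h.coeff 0 ≠ 0) :
    h.reverse.reverse = h := by
  have : h.reverse.natDegree = h.natDegree := by
    rw [reverse_natDegree, natTrailingDegree_eq_zero.2 (Or.inr h0), Nat.sub_zero]
  rw [reverse, this, reverse, reflect_reflect]

theorem natDegree_reflect_le_of_le {N : ℕ} {f : F[X]} (hf : f.natDegree ≤ N) :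
    (reflect N f).natDegree ≤ N := by
  refine natDegree_le_iff_coeff_eq_zero.2 fun m hm => ?_
  rw [coeff_reflect, revAt_eq_self_of_lt hm]
  exact coeff_eq_zero_of_natDegree_lt (hf.trans_lt hm)

theorem reverse_dvd_iff_dvd_reflect {h f : F[X]} {N : ℕ} (h0 : h.coeff 0 ≠ 0)
    (hf : f.natDegree ≤ N) : h.reverse ∣ f ↔ h ∣ reflect N f := by
  constructor
  · intro hd
    have := reverse_dvd_reflect hf hd
    rwa [reverse_reverse_of_coeff_zero_ne h0] at this
  · intro hd
    have := reverse_dvd_reflect (natDegree_reflect_le_of_le hf) hd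
    rwa [reflect_reflect] at this

theorem sum_mul_eq_coeff {n : ℕ} (hn : 0 < n) (u w : Fin n → F) :
    ∑ i, u i * w i = (reflect (n - 1) (toPoly u) * toPoly w).coeff (n - 1) := by
  rw [coeff_mul, Finset.Nat.sum_antidiagonal_eq_sum_range_succ_mk, Nat.succ_eq_add_one,
    Nat.sub_add_cancel hn, ← Finset.sum_range_reflect, ← Fin.sum_univ_eq_sum_range]
  refine Finset.sum_congr rfl fun i _ => ?_
  have := i.isLt
  have h1 : n - 1 - (n - 1 - (i : ℕ)) = i := by omega
  simp [coeff_reflect, revAt_le, coeff_toPoly, h1]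

theorem coeff_zero_ne_zero_of_mul_eq {n : ℕ} (hn : 0 < n) {a : F} (ha : a ≠ 0) {g h : F[X]}
    (hgh : X ^ n - C a = g * h) : h.coeff 0 ≠ 0 := by
  intro h0
  have := congrArg (fun P => P.coeff 0) hgh
  simp [mul_coeff_zero, h0, hn.ne, ha] at this

theorem coeff_pred_mul_eq_zero {n : ℕ} (hn : 0 < n) {a : F} {U P s : F[X]}
    (hU : U.natDegree ≤ n - 1) (hP : P.degree < n) (h : U * P = s * (X ^ n - C a)) :
    (U * P).coeff (n - 1) = 0 := by
  rcases eq_or_ne s 0 with rfl | hs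
  · simp [h]
  have hPn : P.natDegree ≤ n - 1 := by
    rcases eq_or_ne P 0 with rfl | hP0
    · simp
    · have := (natDegree_lt_iff_degree_lt hP0).2 hP
      omega
  have hd : s.natDegree + n ≤ (n - 1) + (n - 1) := by
    have := natDegree_mul_le_of_le hU hPn
    rwa [h, natDegree_mul hs (X_pow_sub_C_ne_zero hn a), natDegree_X_pow_sub_C] at this
  rw [h, mul_sub, coeff_sub, coeff_mul_X_pow', if_neg (by omega), coeff_mul_C,
    coeff_eq_zero_of_natDegree_lt (by omega)]
  simp

/-- The dual of the constacyclic code generated by `g` is generated by the reverse of the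
check polynomial `h`. -/
theorem dual_iff_reverse_dvd {n : ℕ} (hn : 0 < n) {a : F} (ha : a ≠ 0) {g h : F[X]}
    (hgh : X ^ n - C a = g * h) (u : Fin n → F) :
    (∀ w : Fin n → F, g ∣ toPoly w → ∑ i, u i * w i = 0) ↔ h.reverse ∣ toPoly u := by
  have hdeg : (toPoly u).natDegree ≤ n - 1 := by
    refine natDegree_le_iff_coeff_eq_zero.2 fun m hm => ?_
    rw [coeff_toPoly, dif_neg (by omega)]
  have hUdeg := natDegree_reflect_le_of_le hdeg
  rw [reverse_dvd_iff_dvd_reflect (coeff_zero_ne_zero_of_mul_eq hn ha hgh) hdeg]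
  simp only [sum_mul_eq_coeff hn]
  set U := reflect (n - 1) (toPoly u)
  have hne : g * h ≠ 0 := hgh ▸ X_pow_sub_C_ne_zero hn a
  have hg : g ≠ 0 := left_ne_zero_of_mul hne
  have hh : h ≠ 0 := right_ne_zero_of_mul hne
  have hsum : g.natDegree + h.natDegree = n := by
    rw [← natDegree_mul hg hh, ← hgh, natDegree_X_pow_sub_C]
  constructor
  · intro H
    rw [← EuclideanDomain.mod_eq_zero]
    by_contra hr
    set r := U % h with hrdef
    have hrh : r.natDegree < h.natDegree :=
      natDegree_lt_natDegree hr (degree_mod_lt U hh)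
    set P := g * X ^ (h.natDegree - 1 - r.natDegree) with hPdef
    have hPdeg : P.natDegree = g.natDegree + (h.natDegree - 1 - r.natDegree) := by
      rw [natDegree_mul hg (pow_ne_zero _ X_ne_zero), natDegree_X_pow]
    have hP0 : P ≠ 0 := mul_ne_zero hg (pow_ne_zero _ X_ne_zero)
    have hPlt : P.degree < n := (natDegree_lt_iff_degree_lt hP0).1 (by omega)
    have h1 := H (fun i => P.coeff i) (by rw [toPoly_coeff hPlt]; exact dvd_mul_right _ _)
    rw [toPoly_coeff hPlt] at h1
    have hmod : h * (U / h) = U - r := by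
      linear_combination EuclideanDomain.div_add_mod U h
    have h2 : ((U - r) * P).coeff (n - 1) = 0 := by
      refine coeff_pred_mul_eq_zero hn (a := a)
        (s := U / h * X ^ (h.natDegree - 1 - r.natDegree)) ?_ hPlt ?_
      · exact (natDegree_sub_le_of_le hUdeg (by omega : r.natDegree ≤ n - 1)).trans (by simp)
      · rw [← hmod, hgh, hPdef]; ring
    rw [sub_mul, coeff_sub, h1, zero_sub, neg_eq_zero] at h2
    have hnd : (r * P).natDegree = n - 1 := by
      rw [natDegree_mul hr hP0, hPdeg]; omega
    rw [← hnd, coeff_natDegree, leadingCoeff_eq_zero] at h2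
    exact mul_ne_zero hr hP0 h2
  · rintro ⟨s, hs⟩ w ⟨q, hq⟩
    refine coeff_pred_mul_eq_zero hn (a := a) (s := s * q) hUdeg (degree_toPoly_lt w) ?_
    rw [hs, hq, hgh]; ring

theorem reverse_dvd_X_pow_sub_C_inv {n : ℕ} {a : F} (ha : a ≠ 0) {g h : F[X]}
    (hgh : X ^ n - C a = g * h) : h.reverse ∣ X ^ n - C a⁻¹ := by
  have h1 := reverse_dvd_reflect (N := n) (natDegree_X_pow_sub_C (r := a)).le
    (hgh ▸ dvd_mul_left h g)
  have h2 : reflect n (X ^ n - C a) = C (-a) * (X ^ n - C a⁻¹) := by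
    rw [reflect_sub, reflect_monomial, reflect_C, revAt_le le_rfl, mul_sub, ← C_mul]
    simp [ha]
    ring
  rw [h2] at h1
  exact (IsUnit.dvd_mul_left (isUnit_C.2 (neg_ne_zero.2 ha).isUnit)).1 h1

end Field

section Prod

variable {p : ℕ}

theorem prod_polynomial_ext {S T : Type*} [Semiring S] [Semiring T] {P Q : (S × T)[X]}
    (h1 : P.map (RingHom.fst S T) = Q.map (RingHom.fst S T))
    (h2 : P.map (RingHom.snd S T) = Q.map (RingHom.snd S T)) : P = Q := by
  ext i
  · simpa using congrArg (fun P => P.coeff i) h1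
  · simpa using congrArg (fun P => P.coeff i) h2

theorem map_fst_map_ofFHom (f : (ZMod p)[X]) :
    (f.map (ofFHom p)).map (RingHom.fst _ _) = f := by
  rw [Polynomial.map_map]
  exact Polynomial.map_id

theorem map_snd_map_ofFHom (f : (ZMod p)[X]) :
    (f.map (ofFHom p)).map (RingHom.snd _ _) = f := by
  rw [Polynomial.map_map]
  exact Polynomial.map_id

/-- The polynomial over `ZMod p × ZMod p` with second component `f` and first component `g`. -/
noncomputable def combine (f g : (ZMod p)[X]) : (ZMod p × ZMod p)[X] :=
  C (vR p) * f.map (ofFHom p) + (1 - C (vR p)) * g.map (ofFHom p)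

theorem map_fst_combine (f g : (ZMod p)[X]) : (combine f g).map (RingHom.fst _ _) = g := by
  simp [combine, map_fst_map_ofFHom, vR]

theorem map_snd_combine (f g : (ZMod p)[X]) : (combine f g).map (RingHom.snd _ _) = f := by
  simp [combine, map_snd_map_ofFHom, vR]

theorem mk_mem_span_combine_iff {n : ℕ} {θ : ZMod p × ZMod p} {f g : (ZMod p)[X]}
    (hf : f ∣ X ^ n - C θ.2) (hg : g ∣ X ^ n - C θ.1) (P : (ZMod p × ZMod p)[X]) :
    Ideal.Quotient.mk (Ideal.span {X ^ n - C θ}) P ∈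
        Ideal.span {Ideal.Quotient.mk (Ideal.span {X ^ n - C θ}) (combine f g)} ↔
      f ∣ P.map (RingHom.snd _ _) ∧ g ∣ P.map (RingHom.fst _ _) := by
  constructor
  · intro hP
    obtain ⟨q, hq⟩ := Ideal.mem_span_singleton'.1 hP
    obtain ⟨Q, rfl⟩ := Ideal.Quotient.mk_surjective q
    rw [← map_mul, Ideal.Quotient.eq, Ideal.mem_span_singleton] at hq
    constructor
    · have := Polynomial.map_dvd (RingHom.snd _ _) hq
      simp only [Polynomial.map_sub, Polynomial.map_mul, Polynomial.map_pow, map_X, map_C,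
        map_snd_combine] at this
      exact (dvd_sub_right (dvd_mul_left _ _)).1 (hf.trans this)
    · have := Polynomial.map_dvd (RingHom.fst _ _) hq
      simp only [Polynomial.map_sub, Polynomial.map_mul, Polynomial.map_pow, map_X, map_C,
        map_fst_combine] at this
      exact (dvd_sub_right (dvd_mul_left _ _)).1 (hg.trans this)
  · rintro ⟨⟨a, ha⟩, ⟨b, hb⟩⟩
    refine Ideal.mem_span_singleton'.2 ⟨Ideal.Quotient.mk _ (combine a b), ?_⟩
    rw [← map_mul]
    refine congrArg _ (prod_polynomial_ext ?_ ?_)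
    · rw [Polynomial.map_mul, map_fst_combine, map_fst_combine, hb, mul_comm]
    · rw [Polynomial.map_mul, map_snd_combine, map_snd_combine, ha, mul_comm]

theorem span_pair_eq_span_combine (I : Ideal (ZMod p × ZMod p)[X]) (f g : (ZMod p)[X]) :
    Ideal.span {Ideal.Quotient.mk I (C (vR p) * f.map (ofFHom p)),
        Ideal.Quotient.mk I ((1 - C (vR p)) * g.map (ofFHom p))} =
      Ideal.span {Ideal.Quotient.mk I (combine f g)} := by
  have hv : (C (vR p) : (ZMod p × ZMod p)[X]) * C (vR p) = C (vR p) := by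
    rw [← C_mul]; simp [vR]
  apply le_antisymm
  · rw [Ideal.span_le, Set.insert_subset_iff, Set.singleton_subset_iff]
    constructor
    · refine Ideal.mem_span_singleton'.2 ⟨Ideal.Quotient.mk _ (C (vR p)), ?_⟩
      rw [← map_mul]
      refine congrArg _ ?_
      rw [combine]
      linear_combination (f.map (ofFHom p) - g.map (ofFHom p)) * hv
    · refine Ideal.mem_span_singleton'.2 ⟨Ideal.Quotient.mk _ (1 - C (vR p)), ?_⟩
      rw [← map_mul]
      refine congrArg _ ?_
      rw [combine]
      linear_combination (g.map (ofFHom p) - f.map (ofFHom p)) * hv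
  · rw [Ideal.span_singleton_le_iff_mem, combine, map_add]
    exact Ideal.add_mem _ (Ideal.subset_span (by simp)) (Ideal.subset_span (by simp))

end Prod

theorem recip_dvd_iff {p : ℕ} [Fact p.Prime] {h f : (ZMod p)[X]} (h0 : h.coeff 0 ≠ 0) :
    recip h ∣ f ↔ h.reverse ∣ f :=
  IsUnit.mul_left_dvd (isUnit_C.2 (inv_ne_zero h0).isUnit)


/-- **Theorem 9 (2).** Let `p` be an odd prime, `R = F_p + vF_p` with
`v² = v`, `θ = λ + vμ` a unit of `R`, and `C` a `θ`-constacyclic code of length `n`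
over `R` with generating set in standard form `{v·g_{1-v}(x), (1-v)·g_v(x)}`.  Write
`x^n - (λ+μ) = g_{1-v}(x)h_{1-v}(x)` and `x^n - λ = g_v(x)h_v(x)`.  Then, under the
identification of `R^n` with `R[x]/⟨x^n - θ⁻¹⟩`, the dual code is the principal ideal
`C^⊥ = ⟨v·h*_{1-v}(x) + (1-v)·h*_v(x)⟩`. -/
theorem dual_principal_generator (p n : ℕ) (hp : p.Prime) (hodd : Odd p) (hn : 0 < n)
    (lam mu : ZMod p) (hθ : IsUnit (ofFHom p lam + vR p * ofFHom p mu))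
    (C : Submodule (ZMod p × ZMod p) (Fin n → ZMod p × ZMod p))
    (hCc : IsConstacyclic (ofFHom p lam + vR p * ofFHom p mu)
      (C : Set (Fin n → ZMod p × ZMod p)))
    (g1v gv h1v hv : (ZMod p)[X])
    (hg1v_monic : g1v.Monic ∨ g1v = 0) (hgv_monic : gv.Monic ∨ gv = 0)
    (hg1v_dvd : g1v ≠ 0 → g1v ∣ (X : (ZMod p)[X]) ^ n - Polynomial.C (lam + mu))
    (hgv_dvd : gv ≠ 0 → gv ∣ (X : (ZMod p)[X]) ^ n - Polynomial.C lam)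
    (hgen : {x : (ZMod p × ZMod p)[X] ⧸
        Ideal.span {(X : (ZMod p × ZMod p)[X]) ^ n -
          Polynomial.C (ofFHom p lam + vR p * ofFHom p mu)} |
        ∃ c ∈ C, x = Ideal.Quotient.mk _ (toPoly c)} =
      ↑(Ideal.span
        {Ideal.Quotient.mk (Ideal.span {(X : (ZMod p × ZMod p)[X]) ^ n -
            Polynomial.C (ofFHom p lam + vR p * ofFHom p mu)})
          (Polynomial.C (vR p) * g1v.map (ofFHom p)),
         Ideal.Quotient.mk (Ideal.span {(X : (ZMod p × ZMod p)[X]) ^ n -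
            Polynomial.C (ofFHom p lam + vR p * ofFHom p mu)})
          ((1 - Polynomial.C (vR p)) * gv.map (ofFHom p))}))
    (hf1 : (X : (ZMod p)[X]) ^ n - Polynomial.C (lam + mu) = g1v * h1v)
    (hf2 : (X : (ZMod p)[X]) ^ n - Polynomial.C lam = gv * hv) :
    {x : (ZMod p × ZMod p)[X] ⧸
        Ideal.span {(X : (ZMod p × ZMod p)[X]) ^ n -
          Polynomial.C (Ring.inverse (ofFHom p lam + vR p * ofFHom p mu))} |
        ∃ u ∈ dualCode (C : Set (Fin n → ZMod p × ZMod p)),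
          x = Ideal.Quotient.mk _ (toPoly u)} =
      ↑(Ideal.span
        {Ideal.Quotient.mk (Ideal.span {(X : (ZMod p × ZMod p)[X]) ^ n -
            Polynomial.C (Ring.inverse (ofFHom p lam + vR p * ofFHom p mu))})
          (Polynomial.C (vR p) * (recip h1v).map (ofFHom p) +
            (1 - Polynomial.C (vR p)) * (recip hv).map (ofFHom p))}) := by
  have : Fact p.Prime := ⟨hp⟩
  set θ := ofFHom p lam + vR p * ofFHom p mu with hθdef
  have hθ1 : θ.1 = lam := by simp [hθdef, ofFHom, vR]
  have hθ2 : θ.2 = lam + mu := by simp [hθdef, ofFHom, vR]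
  have hinv := Ring.mul_inverse_cancel θ hθ
  have hi1 : lam * (Ring.inverse θ).1 = 1 := by simpa [hθ1] using congrArg Prod.fst hinv
  have hi2 : (lam + mu) * (Ring.inverse θ).2 = 1 := by simpa [hθ2] using congrArg Prod.snd hinv
  have hl1 : lam ≠ 0 := left_ne_zero_of_mul_eq_one hi1
  have hl2 : lam + mu ≠ 0 := left_ne_zero_of_mul_eq_one hi2
  have hC (w : Fin n → ZMod p × ZMod p) : w ∈ C ↔
      g1v ∣ toPoly (fun i => (w i).2) ∧ gv ∣ toPoly (fun i => (w i).1) := by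
    have h1 := mk_mem_span_combine_iff (θ := θ) (n := n) (f := g1v) (g := gv)
      (by rw [hθ2, hf1]; exact dvd_mul_right _ _)
      (by rw [hθ1, hf2]; exact dvd_mul_right _ _) (toPoly w)
    rw [← span_pair_eq_span_combine, ← SetLike.mem_coe, ← hgen, map_toPoly, map_toPoly] at h1
    refine Iff.trans ⟨fun hw => ⟨w, hw, rfl⟩, ?_⟩ h1
    rintro ⟨c, hc, hcw⟩
    rwa [mk_toPoly_injective hn θ hcw]
  have hdual (u : Fin n → ZMod p × ZMod p) :
      u ∈ dualCode (C : Set (Fin n → ZMod p × ZMod p)) ↔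
        recip h1v ∣ toPoly (fun i => (u i).2) ∧ recip hv ∣ toPoly (fun i => (u i).1) := by
    rw [recip_dvd_iff (coeff_zero_ne_zero_of_mul_eq hn hl2 hf1),
      recip_dvd_iff (coeff_zero_ne_zero_of_mul_eq hn hl1 hf2),
      ← dual_iff_reverse_dvd hn hl2 hf1, ← dual_iff_reverse_dvd hn hl1 hf2]
    have hzero : toPoly (fun _ : Fin n => (0 : ZMod p)) = 0 := by simp [toPoly]
    constructor
    · intro hu
      constructor
      · intro w hw
        simpa [Prod.snd_sum] using congrArg Prod.snd
          (hu (fun i => (0, w i)) ((hC _).2 ⟨hw, by simp [hzero]⟩))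
      · intro w hw
        simpa [Prod.fst_sum] using congrArg Prod.fst
          (hu (fun i => (w i, 0)) ((hC _).2 ⟨by simp [hzero], hw⟩))
    · rintro ⟨h2, h1⟩ w hw
      obtain ⟨hw2, hw1⟩ := (hC w).1 hw
      exact Prod.ext (by simpa [Prod.fst_sum] using h1 _ hw1)
        (by simpa [Prod.snd_sum] using h2 _ hw2)
  have hmem (u : Fin n → ZMod p × ZMod p) :=
    mk_mem_span_combine_iff (θ := Ring.inverse θ) (n := n) (f := recip h1v) (g := recip hv)
      (by
        rw [recip_dvd_iff (coeff_zero_ne_zero_of_mul_eq hn hl2 hf1), eq_inv_of_mul_eq_one_right hi2]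
        exact reverse_dvd_X_pow_sub_C_inv hl2 hf1)
      (by
        rw [recip_dvd_iff (coeff_zero_ne_zero_of_mul_eq hn hl1 hf2), eq_inv_of_mul_eq_one_right hi1]
        exact reverse_dvd_X_pow_sub_C_inv hl1 hf2) (toPoly u)
  simp only [map_toPoly] at hmem
  ext x
  constructor
  · rintro ⟨u, hu, rfl⟩
    exact (hmem u).2 ((hdual u).1 hu)
  · intro hx
    obtain ⟨u, rfl⟩ := exists_toPoly_mk_eq hn _ x
    exact ⟨u, (hdual u).2 ((hmem u).1 hx), rfl⟩
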